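/- There is a universal constant C > 0 with the following property. Let W be a collaboration instance on a finite vertex set V of size n, let γ ≥ 0, and let D be a probability distribution over subsets of V with E_{S~D}[|S|] > 0 and E_{S~D}[Induced(S)] ≤ (1 + γ)·E_{S~D}[|S|]. Then there exists a persuasive identity-independent signaling scheme with at most 3 signals whose cost is at most C·( OPT^IR + γ·n + n·OPT^IR / √(E_{S~D}[|S|]) ). -/

import Mathlib

open Finset

variable {V : Type*}

/-- A collaboration instance: symmetric matrix with entries in [0,1] and unit diagonal. -/
def IsCollab [Fintype V] (W : V → V → ℝ) : Prop :=
  (∀ u v, W u v = W v u) ∧ (∀ u v, 0 ≤ W u v ∧ W u v ≤ 1) ∧ (∀ v, W v v = 1)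

/-- Unit-weight instance: off-diagonal entries are 0 or 1. -/
def UnitWeight (W : V → V → ℝ) : Prop :=
  ∀ u v : V, u ≠ v → W u v = 0 ∨ W u v = 1

/-- Feasible solution: nonnegative with `W θ ≥ 1` coordinatewise. -/
def Feasible [Fintype V] (W : V → V → ℝ) (θ : V → ℝ) : Prop :=
  (∀ v, 0 ≤ θ v) ∧ ∀ v, 1 ≤ ∑ u, W v u * θ u

/-- Optimal total workload among feasible solutions. -/
noncomputable def OPT [Fintype V] (W : V → V → ℝ) : ℝ :=
  sInf {c : ℝ | ∃ θ : V → ℝ, Feasible W θ ∧ c = ∑ v, θ v}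

/-- Optimal total workload among feasible solutions satisfying IR (`θ ≤ 1`). -/
noncomputable def OPTIR [Fintype V] (W : V → V → ℝ) : ℝ :=
  sInf {c : ℝ | ∃ θ : V → ℝ, Feasible W θ ∧ (∀ v, θ v ≤ 1) ∧ c = ∑ v, θ v}

/-- An identity-independent signaling scheme: a finitely supported probability
distribution over signal functions `s : V → ℝ` whose values lie in a finite
signal space `sig ⊆ [0,1]`. -/
structure Scheme (V : Type*) [Fintype V] where
  sig : Finset ℝ
  sig_mem : ∀ θ ∈ sig, 0 ≤ θ ∧ θ ≤ 1
  supp : Finset (V → ℝ)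
  val_mem : ∀ s ∈ supp, ∀ v : V, s v ∈ sig
  p : (V → ℝ) → ℝ
  p_nonneg : ∀ s ∈ supp, 0 ≤ p s
  p_sum : ∑ s ∈ supp, p s = 1

/-- Expectation of `f` under the scheme's distribution. -/
noncomputable def Scheme.exp [Fintype V] (D : Scheme V) (f : (V → ℝ) → ℝ) : ℝ :=
  ∑ s ∈ D.supp, D.p s * f s

/-- Expected number of vertices receiving signal `θ`. -/
noncomputable def Scheme.Num [Fintype V] (D : Scheme V) (θ : ℝ) : ℝ :=
  D.exp (fun s => ∑ v, if s v = θ then (1 : ℝ) else 0)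

/-- Expected total contribution entering vertices receiving signal `θ`
(the neighborhood sum `∑_{u ∈ N(v)} W v u * s u` equals `∑_{u ≠ v} W v u * s u`). -/
noncomputable def Scheme.Contrib [Fintype V] [DecidableEq V] (D : Scheme V)
    (W : V → V → ℝ) (θ : ℝ) : ℝ :=
  D.exp (fun s => ∑ v, if s v = θ then ∑ u ∈ Finset.univ.erase v, W v u * s u else 0)

/-- The slack of signal `θ`. -/
noncomputable def Scheme.slack [Fintype V] [DecidableEq V] (D : Scheme V)
    (W : V → V → ℝ) (θ : ℝ) : ℝ :=
  D.Contrib W θ - (1 - θ) * D.Num θ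

/-- Persuasiveness: zero slack at positive signals, nonnegative slack at signal 0. -/
def Scheme.Persuasive [Fintype V] [DecidableEq V] (D : Scheme V) (W : V → V → ℝ) : Prop :=
  (∀ θ ∈ D.sig, 0 < θ → D.slack W θ = 0) ∧ ((0 : ℝ) ∈ D.sig → 0 ≤ D.slack W 0)

/-- Cost of a scheme: expected total signal value. -/
noncomputable def Scheme.cost [Fintype V] (D : Scheme V) : ℝ :=
  D.exp (fun s => ∑ v, s v)

/-- Total weight of the cut between `S` and its complement. -/
noncomputable def cutW [Fintype V] [DecidableEq V] (W : V → V → ℝ) (S : Finset V) : ℝ :=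
  ∑ u ∈ S, ∑ v ∈ Sᶜ, W u v

/-- Total weight of the subgraph induced by `S` (including the unit diagonal). -/
noncomputable def inducedW (W : V → V → ℝ) (S : Finset V) : ℝ :=
  ∑ u ∈ S, ∑ v ∈ S, W u v

section Basic

variable [Fintype V] {W : V → V → ℝ}

lemma card_le_inducedW (hW : IsCollab W) (T : Finset V) : (T.card : ℝ) ≤ inducedW W T := by
  have h : ∀ u ∈ T, (1 : ℝ) ≤ ∑ v ∈ T, W u v := fun u hu => by
    rw [← hW.2.2 u]
    exact Finset.single_le_sum (f := fun v => W u v) (fun v _ => (hW.2.1 u v).1) hu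
  simpa [inducedW] using Finset.sum_le_sum h

lemma inducedW_le_univ (hW : IsCollab W) (T : Finset V) : inducedW W T ≤ inducedW W univ := by
  unfold inducedW
  calc ∑ u ∈ T, ∑ v ∈ T, W u v ≤ ∑ u ∈ T, ∑ v, W u v :=
        Finset.sum_le_sum fun u _ => Finset.sum_le_sum_of_subset_of_nonneg (Finset.subset_univ _)
          fun v _ _ => (hW.2.1 u v).1
    _ ≤ ∑ u, ∑ v, W u v :=
        Finset.sum_le_sum_of_subset_of_nonneg (Finset.subset_univ _)
          fun u _ _ => Finset.sum_nonneg fun v _ => (hW.2.1 u v).1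

lemma cutW_nonneg [DecidableEq V] (hW : IsCollab W) (T : Finset V) : 0 ≤ cutW W T :=
  Finset.sum_nonneg fun u _ => Finset.sum_nonneg fun v _ => (hW.2.1 u v).1

lemma one_le_sum_of_feasible [Nonempty V] (hW : IsCollab W) {x : V → ℝ} (hx : Feasible W x) :
    1 ≤ ∑ v, x v := by
  obtain ⟨v⟩ := ‹Nonempty V›
  refine (hx.2 v).trans (Finset.sum_le_sum fun u _ => ?_)
  exact mul_le_of_le_one_left (hx.1 u) (hW.2.1 v u).2

/-- Some individually rational feasible solution is within a factor two of the optimum. -/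
lemma exists_feasible_sum_le_two_mul_OPTIR [Nonempty V] (hW : IsCollab W) :
    ∃ x : V → ℝ, Feasible W x ∧ (∀ v, x v ≤ 1) ∧ ∑ v, x v ≤ 2 * OPTIR W := by
  have hne : {c : ℝ | ∃ θ : V → ℝ, Feasible W θ ∧ (∀ v, θ v ≤ 1) ∧ c = ∑ v, θ v}.Nonempty := by
    refine ⟨_, fun _ => 1, ⟨fun _ => zero_le_one, fun v => ?_⟩, fun _ => le_rfl, rfl⟩
    simp only [mul_one]
    rw [← hW.2.2 v]
    exact Finset.single_le_sum (f := fun u => W v u) (fun u _ => (hW.2.1 v u).1)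
      (Finset.mem_univ v)
  have h1 : 1 ≤ OPTIR W := by
    refine le_csInf hne ?_
    rintro c ⟨x, hx, -, rfl⟩
    exact one_le_sum_of_feasible hW hx
  have hlt : OPTIR W < 2 * OPTIR W := by linarith
  obtain ⟨c, ⟨x, hx, hx1, rfl⟩, hc⟩ := exists_lt_of_csInf_lt hne hlt
  exact ⟨x, hx, hx1, hc.le⟩

/-- Pushing a finite distribution forward along a family of signal functions. -/
lemma exists_scheme_of_family {ι : Type*} [Fintype ι] (sig : Finset ℝ)
    (hsig : ∀ θ ∈ sig, 0 ≤ θ ∧ θ ≤ 1) (f : ι → V → ℝ) (hf : ∀ i v, f i v ∈ sig)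
    (w : ι → ℝ) (hw : ∀ i, 0 ≤ w i) (hw1 : ∑ i, w i = 1) :
    ∃ D : Scheme V, D.sig = sig ∧ ∀ g : (V → ℝ) → ℝ, D.exp g = ∑ i, w i * g (f i) := by
  classical
  have key : ∀ g : (V → ℝ) → ℝ,
      ∑ s ∈ univ.image f, (∑ i with f i = s, w i) * g s = ∑ i, w i * g (f i) := fun g => by
    rw [← Finset.sum_fiberwise_of_maps_to (s := univ) (t := univ.image f) (g := f)
      (fun i _ => Finset.mem_image_of_mem f (Finset.mem_univ i))]
    refine Finset.sum_congr rfl fun s _ => ?_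
    rw [Finset.sum_mul]
    refine Finset.sum_congr rfl fun i hi => ?_
    rw [(Finset.mem_filter.1 hi).2]
  refine ⟨⟨sig, hsig, univ.image f, ?_, fun s => ∑ i with f i = s, w i,
    fun s _ => Finset.sum_nonneg fun i _ => hw i, ?_⟩, rfl, key⟩
  · intro s hs v
    obtain ⟨i, -, rfl⟩ := Finset.mem_image.1 hs
    exact hf i v
  · simpa [hw1] using key fun _ => 1

end Basic

section SchemeConstruction

variable [Fintype V] [DecidableEq V] {W : V → V → ℝ}

lemma slack_eq_exp (D : Scheme V) (W : V → V → ℝ) (θ : ℝ) :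
    D.slack W θ = D.exp fun s => ∑ v, if s v = θ then
      ∑ u ∈ univ.erase v, W v u * s u - (1 - θ) else 0 := by
  unfold Scheme.slack Scheme.Contrib Scheme.Num Scheme.exp
  rw [Finset.mul_sum, ← Finset.sum_sub_distrib]
  refine Finset.sum_congr rfl fun s _ => ?_
  rw [mul_left_comm, ← mul_sub, Finset.mul_sum, ← Finset.sum_sub_distrib]
  congr 1
  refine Finset.sum_congr rfl fun v _ => ?_
  split_ifs <;> ring

/-- The signal function with value `c` on `T` and `0` elsewhere. -/
def signalOn (c : ℝ) (T : Finset V) : V → ℝ := fun v => if v ∈ T then c else 0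

lemma sum_erase_signalOn (c : ℝ) (T : Finset V) (v : V) :
    ∑ u ∈ univ.erase v, W v u * signalOn c T u = c * ∑ u ∈ T.erase v, W v u := by
  have : T.erase v = (univ.erase v).filter (· ∈ T) := by
    ext u; simp [and_comm]
  rw [this, Finset.sum_filter, Finset.mul_sum]
  refine Finset.sum_congr rfl fun u _ => ?_
  unfold signalOn
  split_ifs <;> ring

lemma slack_signalOn_pos (hW : IsCollab W) {c a : ℝ} (hc : 0 < c) (ha : 0 < a) (T : Finset V) :
    (∑ v, if signalOn c T v = a then
      ∑ u ∈ univ.erase v, W v u * signalOn c T u - (1 - a) else 0) =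
      if c = a then c * inducedW W T - T.card else 0 := by
  by_cases hca : c = a
  · subst hca
    have hiff : ∀ v, signalOn c T v = c ↔ v ∈ T := fun v => by
      unfold signalOn; split_ifs with h <;> simp [h, hc.ne]
    simp only [hiff, sum_erase_signalOn, if_true]
    rw [← Finset.sum_filter, Finset.filter_mem_eq_inter, Finset.univ_inter]
    have : ∀ v ∈ T, c * ∑ u ∈ T.erase v, W v u - (1 - c) = c * ∑ u ∈ T, W v u - 1 :=
      fun v hv => by
        rw [← Finset.add_sum_erase T _ hv, hW.2.2 v]; ring
    rw [Finset.sum_congr rfl this, Finset.sum_sub_distrib, ← Finset.mul_sum]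
    simp [inducedW]
  · rw [if_neg hca]
    refine Finset.sum_eq_zero fun v _ => if_neg ?_
    unfold signalOn
    split_ifs
    · exact hca
    · exact ha.ne

lemma slack_signalOn_zero (hW : IsCollab W) {c : ℝ} (hc : 0 < c) (T : Finset V) :
    (∑ v, if signalOn c T v = 0 then
      ∑ u ∈ univ.erase v, W v u * signalOn c T u - (1 - 0) else 0) =
      c * cutW W T - (Tᶜ.card : ℝ) := by
  have hiff : ∀ v, signalOn c T v = 0 ↔ v ∈ Tᶜ := fun v => by
    unfold signalOn; split_ifs with h <;> simp [h, hc.ne']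
  simp only [hiff, sum_erase_signalOn]
  rw [← Finset.sum_filter, Finset.filter_mem_eq_inter, Finset.univ_inter]
  have : ∀ v ∈ Tᶜ, c * ∑ u ∈ T.erase v, W v u - (1 - 0) = c * ∑ u ∈ T, W u v - 1 :=
    fun v hv => by
      rw [Finset.erase_eq_of_notMem (Finset.mem_compl.1 hv), sub_zero]
      simp only [hW.1 v]
  rw [Finset.sum_congr rfl this, Finset.sum_sub_distrib, ← Finset.mul_sum, cutW,
    Finset.sum_comm]
  simp

/-- Two families of random sets, the `b`-th one receiving the signal `c b` balanced to have
zero slack, form a persuasive scheme once the signal `0` has nonnegative slack. -/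
lemma exists_persuasive_of_balanced (hW : IsCollab W) (q : Bool → Finset V → ℝ)
    (hq : ∀ b T, 0 ≤ q b T) (hq1 : ∑ b, ∑ T, q b T = 1) (c : Bool → ℝ)
    (hc : ∀ b, 0 < c b) (hc1 : ∀ b, c b ≤ 1)
    (hbal : ∀ b, ∑ T, q b T * (c b * inducedW W T - T.card) = 0)
    (hzero : 0 ≤ ∑ b, ∑ T, q b T * (c b * cutW W T - (Tᶜ.card : ℝ))) :
    ∃ D : Scheme V, D.sig.card ≤ 3 ∧ D.Persuasive W ∧
      D.cost = ∑ b, ∑ T, q b T * (c b * T.card) := by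
  classical
  obtain ⟨D, hsig, hexp⟩ := exists_scheme_of_family (V := V) (ι := Bool × Finset V)
    {0, c false, c true}
    (by
      intro θ hθ
      simp only [Finset.mem_insert, Finset.mem_singleton] at hθ
      rcases hθ with rfl | rfl | rfl
      · simp
      · exact ⟨(hc _).le, hc1 _⟩
      · exact ⟨(hc _).le, hc1 _⟩)
    (fun i => signalOn (c i.1) i.2)
    (by
      rintro ⟨b, T⟩ v
      unfold signalOn
      cases b <;> dsimp only <;> split_ifs <;> simp)
    (fun i => q i.1 i.2) (fun i => hq _ _) (by rw [Fintype.sum_prod_type]; exact hq1)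
  refine ⟨D, hsig ▸ Finset.card_le_three, ⟨fun θ _ hθ => ?_, fun _ => ?_⟩, ?_⟩
  · rw [slack_eq_exp, hexp, Fintype.sum_prod_type]
    refine Finset.sum_eq_zero fun b _ => ?_
    simp only [slack_signalOn_pos hW (hc b) hθ]
    split_ifs
    · exact hbal b
    · simp
  · rw [slack_eq_exp, hexp, Fintype.sum_prod_type]
    simpa only [slack_signalOn_zero hW (hc _)] using hzero
  · unfold Scheme.cost
    rw [hexp, Fintype.sum_prod_type]
    refine Finset.sum_congr rfl fun b _ => Finset.sum_congr rfl fun T _ => ?_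
    simp [signalOn, mul_comm]

/-- Sending everybody the same signal. -/
lemma exists_persuasive_constant [Nonempty V] (hW : IsCollab W) :
    ∃ D : Scheme V, D.sig.card ≤ 3 ∧ D.Persuasive W ∧
      D.cost = (Fintype.card V : ℝ) * Fintype.card V / inducedW W univ := by
  classical
  have hn : (0 : ℝ) < Fintype.card V := by exact_mod_cast Fintype.card_pos
  have hI : (Fintype.card V : ℝ) ≤ inducedW W univ := by
    simpa using card_le_inducedW hW univ
  have hI0 : 0 < inducedW W univ := hn.trans_le hI
  obtain ⟨D, h3, hp, hcost⟩ := exists_persuasive_of_balanced hW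
    (fun b T => if b = true then if T = univ then 1 else 0 else 0)
    (fun b T => by split_ifs <;> simp)
    (by simp [Finset.sum_ite_eq']) (fun _ => Fintype.card V / inducedW W univ) (fun _ => by positivity)
    (fun _ => (div_le_one hI0).2 hI)
    (fun b => by cases b <;> simp [div_mul_cancel₀ _ hI0.ne'])
    (by simp [cutW])
  refine ⟨D, h3, hp, hcost.trans ?_⟩
  simp
  ring

end SchemeConstruction

section Rounding

variable [Fintype V] [DecidableEq V] {W : V → V → ℝ}

/-- Weights `r` on subsets of `V` describing a random set that contains each `v` with
probability `x v`, pairwise independently. -/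
structure IsRounding (x : V → ℝ) (r : Finset V → ℝ) : Prop where
  nonneg : ∀ T, 0 ≤ r T
  sum_eq : ∑ T, r T = 1
  marginal : ∀ u, ∑ T, (if u ∈ T then r T else 0) = x u
  pair : ∀ u v, u ≠ v → ∑ T, (if u ∈ T ∧ v ∈ T then r T else 0) = x u * x v

lemma exists_isRounding {x : V → ℝ} (h0 : ∀ v, 0 ≤ x v) (h1 : ∀ v, x v ≤ 1) :
    ∃ r, IsRounding x r := by
  have key : ∀ A : Finset V, ∑ T : Finset V,
      (if A ⊆ T then (∏ v ∈ T, x v) * ∏ v ∈ univ \ T, (1 - x v) else 0) = ∏ v ∈ A, x v := by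
    intro A
    have h := Finset.prod_add x (fun v => if v ∈ A then 0 else 1 - x v) univ
    rw [Finset.powerset_univ] at h
    have hl : ∏ v, (x v + if v ∈ A then 0 else 1 - x v) = ∏ v ∈ A, x v := by
      have hA : ∏ v ∈ A, x v = ∏ v, if v ∈ A then x v else 1 := by
        rw [← Finset.prod_filter, Finset.filter_mem_eq_inter, Finset.univ_inter]
      rw [hA]
      refine Finset.prod_congr rfl fun v _ => ?_
      split_ifs <;> ring
    rw [← hl, h]
    refine Finset.sum_congr rfl fun T _ => ?_
    split_ifs with hA
    · congr 1
      refine Finset.prod_congr rfl fun v hv => ?_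
      rw [if_neg fun hvA => (Finset.mem_sdiff.1 hv).2 (hA hvA)]
    · obtain ⟨v, hvA, hvT⟩ := Finset.not_subset.1 hA
      have h0 : ∏ w ∈ univ \ T, (if w ∈ A then 0 else 1 - x w) = 0 :=
        Finset.prod_eq_zero (i := v) (by simpa using hvT) (by simp [hvA])
      rw [h0, mul_zero]
  refine ⟨fun T => (∏ v ∈ T, x v) * ∏ v ∈ univ \ T, (1 - x v), fun T => ?_, ?_, fun u => ?_,
    fun u v huv => ?_⟩
  · exact mul_nonneg (Finset.prod_nonneg fun v _ => h0 v)
      (Finset.prod_nonneg fun v _ => sub_nonneg.2 (h1 v))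
  · simpa using key ∅
  · simpa using key {u}
  · simpa [Finset.insert_subset_iff, Finset.prod_pair huv] using key {u, v}

namespace IsRounding

variable {x : V → ℝ} {r : Finset V → ℝ}

lemma sum_card (hr : IsRounding x r) : ∑ T, r T * (T.card : ℝ) = ∑ v, x v := by
  simp only [← hr.marginal]
  rw [Finset.sum_comm]
  refine Finset.sum_congr rfl fun T _ => ?_
  rw [← Finset.sum_filter, Finset.filter_mem_eq_inter, Finset.univ_inter]
  simp [mul_comm]

lemma sum_inducedW_le (hr : IsRounding x r) (hW : IsCollab W) (h0 : ∀ v, 0 ≤ x v) :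
    ∑ T, r T * inducedW W T ≤ ∑ v, x v + (∑ v, x v) ^ 2 := by
  have h : ∑ T, r T * inducedW W T =
      ∑ u, ∑ v, W u v * ∑ T, (if u ∈ T ∧ v ∈ T then r T else 0) := by
    simp only [Finset.mul_sum]
    rw [Finset.sum_congr rfl fun u _ => Finset.sum_comm, Finset.sum_comm]
    refine Finset.sum_congr rfl fun T _ => ?_
    unfold inducedW
    rw [Finset.mul_sum, ← Finset.univ_inter T, ← Finset.filter_mem_eq_inter, Finset.sum_filter]
    refine Finset.sum_congr rfl fun u _ => ?_
    rw [Finset.sum_filter]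
    by_cases hu : u ∈ T
    · simp [hu, Finset.mul_sum, mul_comm]
    · simp [hu]
  rw [h, sq, Finset.sum_mul_sum, ← Finset.sum_add_distrib]
  refine Finset.sum_le_sum fun u _ => ?_
  have hterm : ∀ v, W u v * ∑ T, (if u ∈ T ∧ v ∈ T then r T else 0) ≤
      (if u = v then x u else 0) + x u * x v := fun v => by
    by_cases huv : u = v
    · subst huv
      simp only [and_self, hr.marginal, hW.2.2, if_true]
      nlinarith [h0 u]
    · rw [hr.pair u v huv, if_neg huv, zero_add]
      exact mul_le_of_le_one_left (mul_nonneg (h0 u) (h0 v)) (hW.2.1 u v).2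
  refine (Finset.sum_le_sum fun v _ => hterm v).trans ?_
  rw [Finset.sum_add_distrib]
  simp

lemma sum_cutW (hr : IsRounding x r) :
    ∑ T, r T * cutW W T = ∑ u, ∑ v ∈ univ.erase u, W u v * (x u * (1 - x v)) := by
  have hpair : ∀ u, ∀ v ∈ univ.erase u, x u * (1 - x v) =
      ∑ T, (if u ∈ T ∧ v ∉ T then r T else 0) := fun u v hv => by
    rw [mul_sub, mul_one, ← hr.pair u v (Finset.ne_of_mem_erase hv).symm, ← hr.marginal u,
      ← Finset.sum_sub_distrib]
    refine Finset.sum_congr rfl fun T _ => ?_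
    by_cases hu : u ∈ T <;> by_cases hv : v ∈ T <;> simp [hu, hv]
  rw [Finset.sum_congr rfl fun u _ => Finset.sum_congr rfl fun v hv => by rw [hpair u v hv]]
  simp only [Finset.mul_sum]
  rw [Finset.sum_congr rfl fun u _ => Finset.sum_comm, Finset.sum_comm]
  refine Finset.sum_congr rfl fun T _ => ?_
  unfold cutW
  rw [Finset.mul_sum, ← Finset.univ_inter T, ← Finset.filter_mem_eq_inter, Finset.sum_filter]
  refine Finset.sum_congr rfl fun u _ => ?_
  by_cases hu : u ∈ T
  · have : (univ.filter (· ∈ T))ᶜ = (univ.erase u).filter (· ∉ T) := by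
      ext v
      simp only [Finset.mem_compl, Finset.mem_filter, Finset.mem_univ, true_and,
        Finset.mem_erase, and_true, iff_and_self]
      rintro hv rfl
      exact hv hu
    rw [this, Finset.sum_filter]
    simp [hu, Finset.mul_sum, mul_comm]
  · simp [hu]

end IsRounding

lemma card_sub_two_mul_le_sum_cut {x : V → ℝ} (hW : IsCollab W) (hx : Feasible W x)
    (h1 : ∀ v, x v ≤ 1) :
    (Fintype.card V : ℝ) - 2 * ∑ v, x v ≤
      ∑ u, ∑ v ∈ univ.erase u, W u v * ((1 - x u) * x v) := by
  have h : ∀ u, 1 - 2 * x u ≤ ∑ v ∈ univ.erase u, W u v * ((1 - x u) * x v) := fun u => by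
    have hu := hx.2 u
    rw [← Finset.add_sum_erase univ _ (Finset.mem_univ u), hW.2.2 u, one_mul] at hu
    have : ∑ v ∈ univ.erase u, W u v * ((1 - x u) * x v) =
        (1 - x u) * ∑ v ∈ univ.erase u, W u v * x v := by
      rw [Finset.mul_sum]
      exact Finset.sum_congr rfl fun v _ => by ring
    rw [this]
    nlinarith [h1 u, sq_nonneg (x u)]
  have := Finset.sum_le_sum fun u (_ : u ∈ univ) => h u
  simpa [Finset.sum_sub_distrib, ← Finset.mul_sum] using this

lemma IsRounding.card_sub_two_mul_le_sum_cutW {x : V → ℝ} {r : Finset V → ℝ}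
    (hr : IsRounding x r) (hW : IsCollab W) (hx : Feasible W x) (h1 : ∀ v, x v ≤ 1) :
    (Fintype.card V : ℝ) - 2 * ∑ v, x v ≤ ∑ T, r T * cutW W T := by
  refine (card_sub_two_mul_le_sum_cut hW hx h1).trans_eq ?_
  rw [hr.sum_cutW]
  simp only [← Finset.filter_ne', Finset.sum_filter]
  rw [Finset.sum_comm]
  refine Finset.sum_congr rfl fun u _ => Finset.sum_congr rfl fun v _ => ?_
  simp only [ne_comm (a := u), hW.1 v u, mul_comm (x u)]

lemma IsRounding.card_sub_two_mul_le_sum_cutW_compl {x : V → ℝ} {r : Finset V → ℝ}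
    (hr : IsRounding (fun v => 1 - x v) r) (hW : IsCollab W) (hx : Feasible W x)
    (h1 : ∀ v, x v ≤ 1) :
    (Fintype.card V : ℝ) - 2 * ∑ v, x v ≤ ∑ T, r T * cutW W T := by
  refine (card_sub_two_mul_le_sum_cut hW hx h1).trans_eq ?_
  rw [hr.sum_cutW]
  simp only [sub_sub_cancel]

end Rounding

section Combination

/-- The balanced signal of a mixture of two random sets is close to one when both random sets
induce little excess weight. -/
lemma one_sub_balanced_signal_le {X s m γ b J K : ℝ} (hX : 0 < X) (hs : 0 < s) (hm : m = s ^ 2)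
    (hb : b = X / s) (hb1 : b ≤ 1) (hγ : 0 ≤ γ) (hJ : X ≤ J) (hJ' : J ≤ X + X ^ 2)
    (hK : m ≤ K) (hK' : K ≤ (1 + γ) * m) :
    1 - ((1 - b) * X + b * m) / ((1 - b) * J + b * K) ≤ γ + X / s := by
  have hb0 : 0 < b := hb ▸ div_pos hX hs
  have hbm : b * m = X * s := by rw [hb, hm]; field_simp
  have hXs : 0 < X * s := mul_pos hX hs
  have hden : X * s ≤ (1 - b) * J + b * K := by
    nlinarith [mul_nonneg (sub_nonneg.2 hb1) (hX.le.trans hJ), mul_le_mul_of_nonneg_left hK hb0.le]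
  have hden0 := hXs.trans_le hden
  rw [one_sub_div hden0.ne', div_le_iff₀ hden0]
  have hratio : 0 ≤ γ + X / s := by positivity
  have hprod : (γ + X / s) * (X * s) = γ * (X * s) + X ^ 2 := by field_simp
  have h1 : (1 - b) * (J - X) ≤ X ^ 2 := by nlinarith [sq_nonneg X]
  have h2 : b * (K - m) ≤ γ * (X * s) := by
    rw [← hbm]; nlinarith
  nlinarith [mul_le_mul_of_nonneg_left hden hratio]

variable [Fintype V] [DecidableEq V] {W : V → V → ℝ}

lemma exists_persuasive_cost_le [Nonempty V] (hW : IsCollab W) {γ : ℝ} (hγ : 0 ≤ γ)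
    {d : Finset V → ℝ} (hd : ∀ T, 0 ≤ d T) (hd1 : ∑ T, d T = 1)
    {m : ℝ} (hm : ∑ T, d T * (T.card : ℝ) = m) (hm0 : 0 < m)
    (hind : ∑ T, d T * inducedW W T ≤ (1 + γ) * m)
    {x : V → ℝ} (hx : Feasible W x) (hx1 : ∀ v, x v ≤ 1) :
    ∃ D : Scheme V, D.sig.card ≤ 3 ∧ D.Persuasive W ∧
      D.cost ≤ 32 * (∑ v, x v + γ * Fintype.card V +
        Fintype.card V * (∑ v, x v) / √m) := by
  obtain ⟨r, hr⟩ := exists_isRounding hx.1 hx1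
  obtain ⟨r', hr'⟩ := exists_isRounding (x := fun v => 1 - x v)
    (fun v => sub_nonneg.2 (hx1 v)) (fun v => sub_le_self _ (hx.1 v))
  have hX1 := one_le_sum_of_feasible hW hx
  have hcut := hr.card_sub_two_mul_le_sum_cutW hW hx hx1
  have hcut' := hr'.card_sub_two_mul_le_sum_cutW_compl hW hx hx1
  have hcard := hr.sum_card
  have hcard' : ∑ T, r' T * (T.card : ℝ) = Fintype.card V - ∑ v, x v := by
    rw [hr'.sum_card]; simp
  have hJ' := hr.sum_inducedW_le hW hx.1
  have hle : ∀ {w : Finset V → ℝ}, (∀ T, 0 ≤ w T) →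
      ∑ T, w T * (T.card : ℝ) ≤ ∑ T, w T * inducedW W T := fun hw =>
    Finset.sum_le_sum fun T _ => mul_le_mul_of_nonneg_left (card_le_inducedW hW T) (hw T)
  have hJ := hle hr.nonneg
  have hK := hle hd
  have hL := hle hr'.nonneg
  have hL' : ∑ T, r' T * inducedW W T ≤ inducedW W univ := by
    calc ∑ T, r' T * inducedW W T ≤ ∑ T, r' T * inducedW W univ :=
          Finset.sum_le_sum fun T _ =>
            mul_le_mul_of_nonneg_left (inducedW_le_univ hW T) (hr'.nonneg T)
      _ = inducedW W univ := by rw [← Finset.sum_mul, hr'.sum_eq, one_mul]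
  have hcutd : 0 ≤ ∑ T, d T * cutW W T :=
    Finset.sum_nonneg fun T _ => mul_nonneg (hd T) (cutW_nonneg hW T)
  have hmn : m ≤ Fintype.card V := by
    rw [← hm]
    calc ∑ T, d T * (T.card : ℝ) ≤ ∑ T, d T * (Fintype.card V : ℝ) :=
          Finset.sum_le_sum fun T _ => mul_le_mul_of_nonneg_left
            (by exact_mod_cast Finset.card_le_univ T) (hd T)
      _ = Fintype.card V := by rw [← Finset.sum_mul, hd1, one_mul]
  have hn1 : (1 : ℝ) ≤ Fintype.card V := by exact_mod_cast Fintype.card_pos (α := V)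
  have hcompl : ∀ T : Finset V, ((Tᶜ.card : ℕ) : ℝ) = Fintype.card V - T.card := fun T => by
    rw [Finset.card_compl, Nat.cast_sub (Finset.card_le_univ T)]
  have hnI : (Fintype.card V : ℝ) ≤ inducedW W univ := by simpa using card_le_inducedW hW univ
  obtain ⟨D₀, h₀3, h₀p, h₀cost⟩ := exists_persuasive_constant hW
  have hs : 0 < √m := Real.sqrt_pos.2 hm0
  have hms : m = √m ^ 2 := (Real.sq_sqrt hm0.le).symm
  rw [hm] at hK
  rw [hcard] at hJ
  rw [hcard'] at hL
  set n : ℝ := (Fintype.card V : ℝ)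
  set X := ∑ v, x v
  set s := √m
  set J := ∑ T, r T * inducedW W T with hJdef
  set K := ∑ T, d T * inducedW W T with hKdef
  set L := ∑ T, r' T * inducedW W T with hLdef
  set I := inducedW W univ
  have hn0 : 0 < n := by linarith
  have hX0 : 0 < X := by linarith
  set R := n * X / s with hRdef
  have hsn : s ≤ n := Real.sqrt_le_iff.2 ⟨hn0.le, by nlinarith only [hmn, hn1]⟩
  have hXR : X ≤ R := by rw [hRdef, le_div_iff₀ hs]; nlinarith only [hsn, hX0]
  have hXsR : X * s ≤ R := by rw [hRdef, le_div_iff₀ hs]; nlinarith only [hms, hmn, hX0]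
  have hγn : 0 ≤ γ * n := by positivity
  have h₀n : D₀.cost ≤ n := by
    rw [h₀cost, div_le_iff₀ (hn0.trans_le hnI)]
    exact mul_le_mul_of_nonneg_left hnI hn0.le
  by_cases hbig : s < X
  · have hnR : n ≤ R := by
      rw [hRdef, le_div_iff₀ hs]
      exact mul_le_mul_of_nonneg_left hbig.le hn0.le
    exact ⟨D₀, h₀3, h₀p, by linarith⟩
  by_cases hbig' : n < 4 * X
  · exact ⟨D₀, h₀3, h₀p, by linarith⟩
  push Not at hbig hbig'
  have hL0 : 0 < L := by linarith
  set η := (n - X) / L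
  have hηL : η * L = n - X := div_mul_cancel₀ _ hL0.ne'
  have hη0 : 0 < η := div_pos (by linarith) hL0
  set Z := γ * n + 4 * R with hZdef
  by_cases hsmall : η * n ≤ 4 * Z
  · refine ⟨D₀, h₀3, h₀p, ?_⟩
    have : D₀.cost ≤ 2 * (η * n) := by
      rw [h₀cost, div_le_iff₀ (hn0.trans_le hnI)]
      nlinarith only [mul_le_mul_of_nonneg_left hL' (mul_pos hη0 hn0).le, hηL, hbig', hn0]
    linarith
  push Not at hsmall
  have hηn : 0 < η * n := mul_pos hη0 hn0
  set l := 4 * Z / (η * n)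
  have hl0 : 0 ≤ l := div_nonneg (by linarith) hηn.le
  have hl1 : l ≤ 1 := (div_le_one hηn).2 hsmall.le
  have hln : l * (η * n) = 4 * Z := div_mul_cancel₀ _ hηn.ne'
  set b := X / s with hbdef
  have hb0 : 0 < b := div_pos hX0 hs
  have hb1 : b ≤ 1 := (div_le_one hs).2 hbig
  have hbn : b * n = R := by rw [hbdef, hRdef]; ring
  have hbm : b * m = X * s := by rw [hbdef, hms]; field_simp
  have hM0 : 0 < (1 - b) * X + b * m :=
    add_pos_of_nonneg_of_pos (mul_nonneg (sub_nonneg.2 hb1) hX0.le) (mul_pos hb0 hm0)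
  have hMle : (1 - b) * X + b * m ≤ (1 - b) * J + b * K :=
    add_le_add (mul_le_mul_of_nonneg_left hJ (sub_nonneg.2 hb1))
      (mul_le_mul_of_nonneg_left hK hb0.le)
  have hθ := one_sub_balanced_signal_le hX0 hs hms hbdef hb1 hγ hJ hJ' hK hind
  set θ := ((1 - b) * X + b * m) / ((1 - b) * J + b * K)
  have hden0 := hM0.trans_le hMle
  have hθM : θ * ((1 - b) * J + b * K) = (1 - b) * X + b * m := div_mul_cancel₀ _ hden0.ne'
  have hθ0 : 0 < θ := div_pos hM0 hden0
  have hθ1 : θ ≤ 1 := (div_le_one hden0).2 hMle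
  have hsumμ : ∀ g : Finset V → ℝ, ∑ T, (1 - l) * ((1 - b) * r T + b * d T) * g T =
      (1 - l) * ((1 - b) * ∑ T, r T * g T + b * ∑ T, d T * g T) := fun g => by
    simp only [Finset.mul_sum, ← Finset.sum_add_distrib]
    exact Finset.sum_congr rfl fun T _ => by ring
  have hsumν : ∀ g : Finset V → ℝ, ∑ T, l * r' T * g T = l * ∑ T, r' T * g T := fun g => by
    simp only [Finset.mul_sum, mul_assoc]
  have hlin : ∀ (w g h : Finset V → ℝ) (a : ℝ),
      ∑ T, w T * (a * g T - h T) = a * ∑ T, w T * g T - ∑ T, w T * h T := fun w g h a => by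
    rw [Finset.mul_sum, ← Finset.sum_sub_distrib]
    exact Finset.sum_congr rfl fun T _ => by ring
  have hcomp : ∀ {w : Finset V → ℝ}, ∑ T, w T = 1 →
      ∑ T, w T * ((Tᶜ.card : ℕ) : ℝ) = n - ∑ T, w T * (T.card : ℝ) := fun {w} hw => by
    simp only [hcompl, mul_sub, Finset.sum_sub_distrib, ← Finset.sum_mul, hw, one_mul]
  have hzeroμ : -Z ≤ (1 - b) * (θ * (∑ T, r T * cutW W T) - (n - X)) +
      b * (θ * (∑ T, d T * cutW W T) - (n - m)) := by
    have h1 : -((γ + X / s) * n) - 2 * X ≤ θ * (∑ T, r T * cutW W T) - (n - X) := by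
      nlinarith only [mul_le_mul_of_nonneg_left hcut hθ0.le,
        mul_le_mul_of_nonneg_right hθ hn0.le, mul_le_mul_of_nonneg_right hθ1 hX0.le, hX0]
    have h2 : -n ≤ θ * (∑ T, d T * cutW W T) - (n - m) := by
      linarith only [mul_nonneg hθ0.le hcutd, hm0]
    have h3 : (γ + X / s) * n = γ * n + R := by rw [← hbn]; ring
    rw [h3] at h1
    nlinarith only [mul_le_mul_of_nonneg_left h1 (sub_nonneg.2 hb1),
      mul_le_mul_of_nonneg_left h2 hb0.le, hbn, hb0, hb1, hγn, hXR, hX0, hZdef]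
  have hzeroν : η * n / 4 ≤ η * (∑ T, r' T * cutW W T) - X := by
    nlinarith only [mul_le_mul_of_nonneg_left hcut' hη0.le,
      mul_le_mul_of_nonneg_left hbig' hη0.le, hsmall, hZdef, hXR, hγn, hX0]
  obtain ⟨D, h3, hp, hcost⟩ := exists_persuasive_of_balanced hW
    (fun c T => if c = true then l * r' T else (1 - l) * ((1 - b) * r T + b * d T))
    (fun c T => by
      have := hr.nonneg T
      have := hr'.nonneg T
      have := hd T
      have := sub_nonneg.2 hl1
      have := sub_nonneg.2 hb1
      split_ifs <;> positivity)
    (by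
      have h1 := hsumμ fun _ => 1
      have h2 := hsumν fun _ => 1
      simp only [mul_one, hr.sum_eq, hr'.sum_eq, hd1] at h1 h2
      rw [Fintype.sum_bool]
      simp only [if_true, Bool.false_eq_true, if_false, h1, h2]
      ring)
    (fun c => if c = true then η else θ)
    (fun c => by split_ifs <;> assumption)
    (fun c => by
      split_ifs
      exacts [(div_le_one hL0).2 hL, hθ1])
    (fun c => by
      cases c
      · simp only [if_false, Bool.false_eq_true, hsumμ, hlin, hcard, hm, ← hJdef, ← hKdef]
        linear_combination (1 - l) * hθM
      · simp only [if_true, hsumν, hlin, hcard', ← hLdef, hηL]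
        ring)
    (by
      rw [Fintype.sum_bool]
      simp only [if_true, Bool.false_eq_true, if_false, hsumμ, hsumν, hlin, hcomp hr.sum_eq,
        hcomp hr'.sum_eq, hcomp hd1, hcard, hcard', hm, sub_sub_cancel]
      have hlZ : 0 ≤ l * Z := mul_nonneg hl0 (by linarith)
      nlinarith only [mul_le_mul_of_nonneg_left hzeroμ (sub_nonneg.2 hl1),
        mul_le_mul_of_nonneg_left hzeroν hl0, hln, hlZ])
  refine ⟨D, h3, hp, ?_⟩
  have hcost' : D.cost = l * (η * (n - X)) + (1 - l) * (θ * ((1 - b) * X + b * m)) := by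
    rw [hcost, Fintype.sum_bool]
    simp only [if_true, Bool.false_eq_true, if_false, hsumμ, hsumν, mul_left_comm _ θ,
      mul_left_comm _ η, ← Finset.mul_sum, hcard, hcard', hm]
  have hμle : (1 - l) * (θ * ((1 - b) * X + b * m)) ≤ X + R := by
    have h1 : θ * ((1 - b) * X + b * m) ≤ (1 - b) * X + b * m :=
      mul_le_of_le_one_left hM0.le hθ1
    have h2 : (1 - l) * (θ * ((1 - b) * X + b * m)) ≤ θ * ((1 - b) * X + b * m) :=
      mul_le_of_le_one_left (by positivity) (by linarith)
    nlinarith only [h1, h2, hbm, hXsR, mul_nonneg hb0.le hX0.le]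
  have hνle : l * (η * (n - X)) ≤ 4 * Z := by
    rw [← hln]
    exact mul_le_mul_of_nonneg_left (mul_le_mul_of_nonneg_left (by linarith) hη0.le) hl0
  rw [hcost']
  linarith

end Combination

/-- There is a universal constant `C > 0` such that: given a
collaboration instance, `γ ≥ 0`, and a distribution over subsets of `V` with
`E[|S|] > 0` and `E[Induced(S)] ≤ (1 + γ)·E[|S|]`, there exists a persuasive
identity-independent signaling scheme with at most 3 signals of cost at most
`C·(OPT^IR + γ·n + n·OPT^IR / √(E[|S|]))`. -/
theorem statement18 :
    ∃ C : ℝ, 0 < C ∧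
      ∀ (V : Type) [Fintype V] [DecidableEq V] (W : V → V → ℝ) (γ : ℝ)
        (dsupp : Finset (Finset V)) (dp : Finset V → ℝ),
        IsCollab W → 0 ≤ γ →
        (∀ S ∈ dsupp, 0 ≤ dp S) → (∑ S ∈ dsupp, dp S = 1) →
        0 < ∑ S ∈ dsupp, dp S * (S.card : ℝ) →
        (∑ S ∈ dsupp, dp S * inducedW W S ≤ (1 + γ) * ∑ S ∈ dsupp, dp S * (S.card : ℝ)) →
        ∃ D : Scheme V, D.sig.card ≤ 3 ∧ D.Persuasive W ∧
          D.cost ≤ C * (OPTIR W + γ * (Fintype.card V : ℝ) +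
            (Fintype.card V : ℝ) * OPTIR W / Real.sqrt (∑ S ∈ dsupp, dp S * (S.card : ℝ))) := by
  refine ⟨64, by norm_num, fun V _ _ W γ dsupp dp hW hγ hdp hdp1 hm0 hind => ?_⟩
  have : Nonempty V := by
    by_contra hV
    rw [not_nonempty_iff] at hV
    simp [Finset.eq_empty_of_isEmpty] at hm0
  obtain ⟨x, hx, hx1, hsum⟩ := exists_feasible_sum_le_two_mul_OPTIR hW
  have hext : ∀ g : Finset V → ℝ,
      ∑ T, (if T ∈ dsupp then dp T else 0) * g T = ∑ S ∈ dsupp, dp S * g S := fun g => by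
    simp [ite_mul]
  obtain ⟨D, h3, hp, hcost⟩ := exists_persuasive_cost_le hW hγ
    (d := fun T => if T ∈ dsupp then dp T else 0)
    (fun T => by split_ifs with h; exacts [hdp T h, le_rfl])
    (by simp [hdp1])
    (hext fun T => (T.card : ℝ)) hm0 (by rw [hext]; exact hind) hx hx1
  refine ⟨D, h3, hp, hcost.trans ?_⟩
  have hR : (Fintype.card V : ℝ) * (∑ v, x v) / √(∑ S ∈ dsupp, dp S * (S.card : ℝ)) ≤
      2 * (Fintype.card V * OPTIR W / √(∑ S ∈ dsupp, dp S * (S.card : ℝ))) := by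
    rw [← mul_div_assoc, mul_left_comm]
    gcongr
  have hγn : 0 ≤ γ * (Fintype.card V : ℝ) := by positivity
  linarith
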